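/- arXiv:math/0601007 — 4 statements merged into one kernel-verified Lean document; each statement's English description precedes it below -/
import Mathlib

section
/- Let F be the centered Gaussian process with covariance E[F(s)F(t)] = (2π)^{-1/2}(√(t+s) − √|t−s|). Fix Δt > 0, set t_j = jΔt and ΔF_j = F(t_j) − F(t_{j−1}). Then for all integers 1 ≤ i < j, | E[ΔF_i ΔF_j] + √(Δt/(2π)) · γ_{j−i} | ≤ Δt² / (t_i + t_j)^{3/2}, where γ_k = 2√k − √(k−1) − √(k+1). -/
open MeasureTheory ProbabilityTheory Filter

/-- The covariance function `K(s,t) = (2π)^{-1/2}(√(t+s) − √|t−s|)`. -/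
noncomputable def covK (s t : ℝ) : ℝ :=
  (Real.sqrt (2 * Real.pi))⁻¹ * (Real.sqrt (t + s) - Real.sqrt |t - s|)

/-- `F` is the centered Gaussian process with covariance `covK`, on a probability
space `(Ω, P)`: every finite linear combination of values of `F` at nonnegative
times is centered Gaussian with the prescribed variance. -/
def IsHeatGaussian {Ω : Type*} [MeasurableSpace Ω] (P : Measure Ω)
    (F : ℝ → Ω → ℝ) : Prop :=
  IsProbabilityMeasure P ∧ (∀ t : ℝ, Measurable (F t)) ∧
  ∀ (m : ℕ) (ts : Fin m → ℝ) (c : Fin m → ℝ), (∀ i, 0 ≤ ts i) →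
    Measure.map (fun ω => ∑ i, c i * F (ts i) ω) P =
      gaussianReal 0 (Real.toNNReal (∑ i, ∑ j, c i * c j * covK (ts i) (ts j)))

/-- `γ_k = 2√k − √(k−1) − √(k+1)`. -/
noncomputable def gam (k : ℕ) : ℝ :=
  2 * Real.sqrt k - Real.sqrt ((k : ℝ) - 1) - Real.sqrt ((k : ℝ) + 1)


/-- The negated second difference of the square root, as a product of three sums of square roots. -/
lemma sqrt_second_diff {x : ℝ} (hx : 1 ≤ x) :
    (2 * √x - √(x - 1) - √(x + 1)) *
      ((√(x - 1) + √x) * (√x + √(x + 1)) * (√(x - 1) + √(x + 1))) = 2 := by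
  have ha : √(x - 1) ^ 2 = x - 1 := Real.sq_sqrt (by linarith)
  have hb : √x ^ 2 = x := Real.sq_sqrt (by linarith)
  have hc : √(x + 1) ^ 2 = x + 1 := Real.sq_sqrt (by linarith)
  set a := √(x - 1)
  set b := √x
  set c := √(x + 1)
  have hab : (b - a) * (a + b) = 1 := by linear_combination hb - ha
  have hbc : (c - b) * (b + c) = 1 := by linear_combination hc - hb
  have hac : (c - a) * (a + c) = 2 := by linear_combination hc - ha
  linear_combination (b + c) * (a + c) * hab - (a + b) * (a + c) * hbc + hac

lemma sqrt_second_diff_nonneg {x : ℝ} (hx : 1 ≤ x) :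
    0 ≤ 2 * √x - √(x - 1) - √(x + 1) := by
  have h := sqrt_second_diff hx
  by_contra! hneg
  have : 0 ≤ (√(x - 1) + √x) * (√x + √(x + 1)) * (√(x - 1) + √(x + 1)) := by positivity
  nlinarith

lemma sqrt_second_diff_le {x : ℝ} (hx : 1 ≤ x) :
    2 * √x - √(x - 1) - √(x + 1) ≤ 2 / 3 := by
  have h := sqrt_second_diff hx
  have h0 := sqrt_second_diff_nonneg hx
  have ha : 0 ≤ √(x - 1) := Real.sqrt_nonneg _
  have hb : 1 ≤ √x := Real.one_le_sqrt.2 hx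
  have hc : 1.4 ≤ √(x + 1) := Real.le_sqrt_of_sq_le (by linarith)
  have h1 : (1 : ℝ) * 2.4 * 1.4 ≤
      (√(x - 1) + √x) * (√x + √(x + 1)) * (√(x - 1) + √(x + 1)) := by
    gcongr <;> linarith
  nlinarith [mul_le_mul_of_nonneg_left h1 h0]

lemma sqrt_second_diff_mul_le {x : ℝ} (hx : 2 ≤ x) :
    (2 * √x - √(x - 1) - √(x + 1)) * √(x + 1) ^ 3 ≤ 2 := by
  have h := sqrt_second_diff (by linarith : 1 ≤ x)
  have h0 := sqrt_second_diff_nonneg (by linarith : 1 ≤ x)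
  have ha : 0 ≤ √(x - 1) := Real.sqrt_nonneg _
  have hab : √(x - 1) ≤ √x := Real.sqrt_le_sqrt (by linarith)
  have hc : 0 ≤ √(x + 1) := Real.sqrt_nonneg _
  have hca : √(x + 1) ≤ 2 * √(x - 1) := by
    rw [Real.sqrt_le_left (by positivity), mul_pow, Real.sq_sqrt (by linarith)]
    linarith
  have h1 : √(x + 1) * √(x + 1) * √(x + 1) ≤
      (√(x - 1) + √x) * (√x + √(x + 1)) * (√(x - 1) + √(x + 1)) := by
    gcongr <;> linarith
  nlinarith [mul_le_mul_of_nonneg_left h1 h0]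

/-- The square of a centered Gaussian variable is integrable, with integral the variance. -/
lemma integral_sq_of_map_eq_gaussianReal {Ω : Type*} [MeasurableSpace Ω] {P : Measure Ω}
    {X : Ω → ℝ} (hX : Measurable X) {v : NNReal} (h : P.map X = gaussianReal 0 v) :
    Integrable (fun ω => X ω ^ 2) P ∧ ∫ ω, X ω ^ 2 ∂P = v := by
  have hm : AEStronglyMeasurable (fun x : ℝ => x ^ 2) (P.map X) := by fun_prop
  have hint : Integrable (fun x : ℝ => x ^ 2) (P.map X) := by
    rw [h]
    exact (memLp_id_gaussianReal (μ := 0) (v := v) 2).integrable_sq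
  refine ⟨(integrable_map_measure hm hX.aemeasurable).1 hint, ?_⟩
  rw [← integral_map hX.aemeasurable hm, h, ← variance_id_gaussianReal (μ := 0) (v := v),
    variance_of_integral_eq_zero aemeasurable_id (by simp)]
  simp

lemma covK_mul {d : ℝ} (hd : 0 ≤ d) (a b : ℝ) :
    covK (a * d) (b * d) = (√(2 * Real.pi))⁻¹ * √d * (√(b + a) - √|b - a|) := by
  rw [covK, ← add_mul, ← sub_mul, abs_mul, abs_of_nonneg hd, Real.sqrt_mul' _ hd,
    Real.sqrt_mul' _ hd]
  ring

/-- The variance of the sum (`e = 1`) or difference (`e = -1`) of two non-overlapping increments. -/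
lemma covK_increment_form {d a b e : ℝ} (hd : 0 ≤ d) (hab : a + 1 ≤ b) (he : e ^ 2 = 1) :
    (∑ k, ∑ l, (![1, -1, e, -e] : Fin 4 → ℝ) k * (![1, -1, e, -e] : Fin 4 → ℝ) l *
      covK ((![a * d, (a - 1) * d, b * d, (b - 1) * d] : Fin 4 → ℝ) k)
        ((![a * d, (a - 1) * d, b * d, (b - 1) * d] : Fin 4 → ℝ) l)) =
    (√(2 * Real.pi))⁻¹ * √d *
      ((2 - (2 * √(2 * a - 1) - √(2 * a - 1 - 1) - √(2 * a - 1 + 1))) +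
       (2 - (2 * √(2 * b - 1) - √(2 * b - 1 - 1) - √(2 * b - 1 + 1))) -
       2 * e * ((2 * √(a + b - 1) - √(a + b - 1 - 1) - √(a + b - 1 + 1)) +
         (2 * √(b - a) - √(b - a - 1) - √(b - a + 1)))) := by
  have h1 : |b - a| = b - a := abs_of_nonneg (by linarith)
  have h2 : |b - 1 - a| = b - a - 1 := by rw [abs_of_nonneg (by linarith)]; ring
  have h3 : |b - (a - 1)| = b - a + 1 := by rw [abs_of_nonneg (by linarith)]; ring
  have h4 : |b - 1 - (a - 1)| = b - a := by rw [abs_of_nonneg (by linarith)]; ring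
  have g1 : |a - b| = b - a := by rw [abs_sub_comm, h1]
  have g2 : |a - (b - 1)| = b - a - 1 := by rw [abs_sub_comm, h2]
  have g3 : |a - 1 - b| = b - a + 1 := by rw [abs_sub_comm, h3]
  have g4 : |a - 1 - (b - 1)| = b - a := by rw [abs_sub_comm, h4]
  have k1 (x : ℝ) : |x - (x - 1)| = 1 := by simp
  have k2 (x : ℝ) : |x - 1 - x| = 1 := by simp
  simp only [Fin.sum_univ_four, Matrix.cons_val, covK_mul hd, h1, h2, h3, h4, g1, g2, g3, g4,
    k1, k2, sub_self, abs_zero, Real.sqrt_zero, Real.sqrt_one]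
  ring_nf
  rw [he]
  ring

/-- Covariance of two increments of length `d` over non-overlapping time intervals. -/
lemma integral_increment_mul {Ω : Type*} [MeasurableSpace Ω] {P : Measure Ω}
    {F : ℝ → Ω → ℝ} (hF : IsHeatGaussian P F) {d a b : ℝ} (hd : 0 ≤ d) (ha : 1 ≤ a)
    (hab : a + 1 ≤ b) :
    ∫ ω, (F (a * d) ω - F ((a - 1) * d) ω) * (F (b * d) ω - F ((b - 1) * d) ω) ∂P =
      -((√(2 * Real.pi))⁻¹ * √d *
        ((2 * √(a + b - 1) - √(a + b - 1 - 1) - √(a + b - 1 + 1)) +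
         (2 * √(b - a) - √(b - a - 1) - √(b - a + 1)))) := by
  obtain ⟨-, hmeas, hgauss⟩ := hF
  have l1 := sqrt_second_diff_le (x := 2 * a - 1) (by linarith)
  have l2 := sqrt_second_diff_le (x := 2 * b - 1) (by linarith)
  have l3 := sqrt_second_diff_le (x := a + b - 1) (by linarith)
  have l4 := sqrt_second_diff_le (x := b - a) (by linarith)
  have p3 := sqrt_second_diff_nonneg (x := a + b - 1) (by linarith)
  have p4 := sqrt_second_diff_nonneg (x := b - a) (by linarith)
  have key (e : ℝ) (he : e = 1 ∨ e = -1) :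
      Integrable (fun ω => ((F (a * d) ω - F ((a - 1) * d) ω) +
        e * (F (b * d) ω - F ((b - 1) * d) ω)) ^ 2) P ∧
      ∫ ω, ((F (a * d) ω - F ((a - 1) * d) ω) +
        e * (F (b * d) ω - F ((b - 1) * d) ω)) ^ 2 ∂P =
      (√(2 * Real.pi))⁻¹ * √d *
      ((2 - (2 * √(2 * a - 1) - √(2 * a - 1 - 1) - √(2 * a - 1 + 1))) +
       (2 - (2 * √(2 * b - 1) - √(2 * b - 1 - 1) - √(2 * b - 1 + 1))) -
       2 * e * ((2 * √(a + b - 1) - √(a + b - 1 - 1) - √(a + b - 1 + 1)) +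
         (2 * √(b - a) - √(b - a - 1) - √(b - a + 1)))) := by
    have hg := hgauss 4 ![a * d, (a - 1) * d, b * d, (b - 1) * d] ![1, -1, e, -e] (by
      intro k
      fin_cases k <;> simp <;> apply mul_nonneg <;> linarith)
    rw [covK_increment_form hd hab (by rcases he with rfl | rfl <;> norm_num)] at hg
    have h := integral_sq_of_map_eq_gaussianReal (by fun_prop) hg
    rw [Real.coe_toNNReal] at h
    · convert h using 5 <;> simp only [Fin.sum_univ_four, Matrix.cons_val] <;> ring
    · refine mul_nonneg (by positivity) ?_
      rcases he with rfl | rfl <;> linarith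
  obtain ⟨i1, e1⟩ := key 1 (Or.inl rfl)
  obtain ⟨i2, e2⟩ := key (-1) (Or.inr rfl)
  have hpol : (fun ω => (F (a * d) ω - F ((a - 1) * d) ω) *
      (F (b * d) ω - F ((b - 1) * d) ω)) = fun ω => (1 / 4 : ℝ) *
      (((F (a * d) ω - F ((a - 1) * d) ω) + 1 * (F (b * d) ω - F ((b - 1) * d) ω)) ^ 2 -
       ((F (a * d) ω - F ((a - 1) * d) ω) + (-1) * (F (b * d) ω - F ((b - 1) * d) ω)) ^ 2) := by
    funext ω
    ring
  rw [hpol, integral_const_mul, integral_sub i1 i2, e1, e2]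
  ring

/-- Lemma 2.1, inequality (2.4): for a uniform grid `t_j = jΔt` and increments
`ΔF_j = F(t_j) − F(t_{j−1})`, for all `1 ≤ i < j`,
`|E[ΔF_i ΔF_j] + √(Δt/(2π)) γ_{j−i}| ≤ Δt²/(t_i + t_j)^{3/2}`. -/
theorem heat_increment_cov_estimate {Ω : Type*} [MeasurableSpace Ω]
    (P : Measure Ω) (F : ℝ → Ω → ℝ) (hF : IsHeatGaussian P F)
    (Δt : ℝ) (hΔt : 0 < Δt) (i j : ℕ) (hi : 1 ≤ i) (hij : i < j) :
    |(∫ ω, (F ((i : ℝ) * Δt) ω - F (((i : ℝ) - 1) * Δt) ω) *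
          (F ((j : ℝ) * Δt) ω - F (((j : ℝ) - 1) * Δt) ω) ∂P) +
        Real.sqrt (Δt / (2 * Real.pi)) * gam (j - i)| ≤
      Δt ^ 2 / ((i : ℝ) * Δt + (j : ℝ) * Δt) ^ ((3 : ℝ) / 2) := by
  have hi' : (1 : ℝ) ≤ i := by exact_mod_cast hi
  have hij' : (i : ℝ) + 1 ≤ j := by exact_mod_cast hij
  rw [integral_increment_mul hF hΔt.le hi' hij', gam, Nat.cast_sub hij.le,
    Real.sqrt_div hΔt.le, ← add_mul, mul_comm _ Δt, Real.rpow_div_two_eq_sqrt _ (by positivity),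
    Real.sqrt_mul hΔt.le]
  have hb := sqrt_second_diff_mul_le (x := (i : ℝ) + j - 1) (by linarith)
  have h0 := sqrt_second_diff_nonneg (x := (i : ℝ) + j - 1) (by linarith)
  rw [sub_add_cancel] at hb h0 ⊢
  set g := 2 * √((i : ℝ) + j - 1) - √((i : ℝ) + j - 1 - 1) - √((i : ℝ) + j)
  set γ := 2 * √((j : ℝ) - i) - √((j : ℝ) - i - 1) - √((j : ℝ) - i + 1)
  have hr : 2 ≤ √(2 * Real.pi) :=
    Real.le_sqrt_of_sq_le (by linarith [Real.pi_gt_three])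
  have hs : 0 < √Δt := Real.sqrt_pos.2 hΔt
  have hn : 0 < √((i : ℝ) + j) := Real.sqrt_pos.2 (by linarith)
  have hss : √Δt ^ 2 = Δt := Real.sq_sqrt hΔt.le
  have heq : -((√(2 * Real.pi))⁻¹ * √Δt * (g + γ)) + √Δt / √(2 * Real.pi) * γ =
      -(√Δt * g / √(2 * Real.pi)) := by ring
  rw [heq, abs_neg, abs_of_nonneg (by positivity)]
  have h3 : (√Δt * √((i : ℝ) + j)) ^ (3 : ℝ) = (√Δt * √((i : ℝ) + j)) ^ 3 := by
    exact_mod_cast Real.rpow_natCast _ 3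
  rw [h3, div_le_div_iff₀ (by positivity) (by positivity)]
  calc √Δt * g * (√Δt * √((i : ℝ) + j)) ^ 3
      = (√Δt ^ 2) ^ 2 * (g * √((i : ℝ) + j) ^ 3) := by ring
    _ ≤ Δt ^ 2 * √(2 * Real.pi) := by
        rw [hss]
        gcongr
        linarith
end

section
/- Let F be the centered Gaussian process with covariance E[F(s)F(t)] = (2π)^{-1/2}(√(t+s) − √|t−s|). Then for all 0 ≤ s < t ≤ u < v, | E[ (F(v) − F(u)) (F(t) − F(s)) ] | ≤ √(2/π) · (t − s)(v − u) / ( (u − s) √(v − t) ). -/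
open MeasureTheory ProbabilityTheory Filter

/-- A random variable with law `N(0, q)` is square integrable with second moment `q`. -/
theorem memLp_two_and_integral_sq_of_map_eq_gaussianReal {Ω : Type*} [MeasurableSpace Ω]
    {P : Measure Ω} {X : Ω → ℝ} (hX : Measurable X) {q : ℝ} (hq : 0 ≤ q)
    (h : Measure.map X P = gaussianReal 0 q.toNNReal) :
    MemLp X 2 P ∧ ∫ ω, X ω ^ 2 ∂P = q := by
  have hL : MemLp X 2 P := by
    have := memLp_id_gaussianReal (μ := 0) (v := q.toNNReal) 2
    rw [← h] at this
    exact (memLp_map_measure_iff (by fun_prop) hX.aemeasurable).1 this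
  refine ⟨hL, ?_⟩
  have hsq : ∫ x, x ^ 2 ∂(Measure.map X P) = ∫ ω, X ω ^ 2 ∂P :=
    integral_map hX.aemeasurable (by fun_prop)
  rw [← hsq, h]
  have hv := variance_id_gaussianReal (μ := 0) (v := q.toNNReal)
  rw [variance_of_integral_eq_zero (by fun_prop) (by simp)] at hv
  simpa [hq] using hv

theorem covK_nonneg {s t : ℝ} (hs : 0 ≤ s) (ht : 0 ≤ t) : 0 ≤ covK s t := by
  unfold covK
  have : Real.sqrt |t - s| ≤ Real.sqrt (t + s) :=
    Real.sqrt_le_sqrt (abs_le.2 ⟨by linarith, by linarith⟩)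
  exact mul_nonneg (by positivity) (by linarith)

theorem covK_comm (s t : ℝ) : covK s t = covK t s := by
  unfold covK
  rw [add_comm t s, abs_sub_comm]

namespace IsHeatGaussian

variable {Ω : Type*} [MeasurableSpace Ω] {P : Measure Ω} {F : ℝ → Ω → ℝ}

theorem memLp_two_and_integral_sq (hF : IsHeatGaussian P F) {t : ℝ} (ht : 0 ≤ t) :
    MemLp (F t) 2 P ∧ ∫ ω, F t ω ^ 2 ∂P = covK t t := by
  have h := hF.2.2 1 (fun _ => t) (fun _ => 1) (fun _ => ht)
  simp only [Fin.sum_univ_one, one_mul] at h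
  exact memLp_two_and_integral_sq_of_map_eq_gaussianReal (hF.2.1 t) (covK_nonneg ht ht) h

theorem integral_mul (hF : IsHeatGaussian P F) {s t : ℝ} (hs : 0 ≤ s) (ht : 0 ≤ t) :
    ∫ ω, F s ω * F t ω ∂P = covK s t := by
  have h := hF.2.2 2 ![s, t] (fun _ => 1) (by simp [Fin.forall_fin_two, hs, ht])
  simp only [Fin.sum_univ_two, one_mul, Matrix.cons_val_zero, Matrix.cons_val_one] at h
  have hss := covK_nonneg hs hs
  have hst := covK_nonneg hs ht
  have hts := covK_nonneg ht hs
  have htt := covK_nonneg ht ht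
  have hsum := (memLp_two_and_integral_sq_of_map_eq_gaussianReal
    ((hF.2.1 s).add (hF.2.1 t)) (by positivity) h).2
  obtain ⟨hLs, hIs⟩ := hF.memLp_two_and_integral_sq hs
  obtain ⟨hLt, hIt⟩ := hF.memLp_two_and_integral_sq ht
  have hmul : Integrable (fun ω => F s ω * F t ω) P := hLs.integrable_mul hLt
  have hexp : ∫ ω, (F s ω + F t ω) ^ 2 ∂P =
      ∫ ω, F s ω ^ 2 ∂P + 2 * ∫ ω, F s ω * F t ω ∂P + ∫ ω, F t ω ^ 2 ∂P := by
    have hadd : Integrable (fun ω => F s ω ^ 2 + 2 * (F s ω * F t ω)) P :=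
      hLs.integrable_sq.add (hmul.const_mul 2)
    rw [← integral_const_mul, ← integral_add hLs.integrable_sq (hmul.const_mul 2),
      ← integral_add hadd hLt.integrable_sq]
    congr 1 with ω
    ring
  simp only [Pi.add_apply] at hsum
  rw [hexp, hIs, hIt, covK_comm t s] at hsum
  linarith

theorem integral_sub_mul_sub (hF : IsHeatGaussian P F) {s t u v : ℝ}
    (hs : 0 ≤ s) (ht : 0 ≤ t) (hu : 0 ≤ u) (hv : 0 ≤ v) :
    ∫ ω, (F v ω - F u ω) * (F t ω - F s ω) ∂P =
      covK v t - covK v s - (covK u t - covK u s) := by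
  have hi : ∀ {x y : ℝ}, 0 ≤ x → 0 ≤ y → Integrable (fun ω => F x ω * F y ω) P :=
    fun hx hy => (hF.memLp_two_and_integral_sq hx).1.integrable_mul
      (hF.memLp_two_and_integral_sq hy).1
  have hsub : ∀ {x : ℝ}, 0 ≤ x → Integrable (fun ω => F x ω * F t ω - F x ω * F s ω) P :=
    fun hx => (hi hx ht).sub (hi hx hs)
  rw [← hF.integral_mul hv ht, ← hF.integral_mul hv hs, ← hF.integral_mul hu ht,
    ← hF.integral_mul hu hs, ← integral_sub (hi hv ht) (hi hv hs),
    ← integral_sub (hi hu ht) (hi hu hs),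
    ← integral_sub (hsub hv) (hsub hu)]
  congr 1 with ω
  ring

end IsHeatGaussian

/-- The mixed second difference of the square root, in a form that is visibly nonnegative and
decreasing in `x`. -/
theorem sqrt_mixed_difference {x b d : ℝ} (hx : 0 ≤ x) (hb : 0 < b) (hd : 0 < d) :
    √(x + b) - √x - √(x + b + d) + √(x + d) =
      b * d * ((√(x + b + d) + √(x + b))⁻¹ + (√(x + d) + √x)⁻¹) *
        ((√(x + b) + √x)⁻¹ * (√(x + b + d) + √(x + d))⁻¹) := by
  have hq := Real.sqrt_nonneg x
  have hp : 0 < √(x + b) := Real.sqrt_pos.2 (by linarith)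
  have hQ : 0 < √(x + d) := Real.sqrt_pos.2 (by linarith)
  have hP : 0 < √(x + b + d) := Real.sqrt_pos.2 (by linarith)
  have hq2 := Real.sq_sqrt hx
  have hp2 := Real.sq_sqrt (show 0 ≤ x + b by linarith)
  have hQ2 := Real.sq_sqrt (show 0 ≤ x + d by linarith)
  have hP2 := Real.sq_sqrt (show 0 ≤ x + b + d by linarith)
  generalize √x = q at *
  generalize √(x + b) = p at *
  generalize √(x + d) = Q at *
  generalize √(x + b + d) = R at *
  have h₁ : d * (R + p)⁻¹ = R - p := by
    rw [mul_inv_eq_iff_eq_mul₀ (by positivity)]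
    linear_combination hp2 - hP2
  have h₂ : d * (Q + q)⁻¹ = Q - q := by
    rw [mul_inv_eq_iff_eq_mul₀ (by positivity)]
    linear_combination hq2 - hQ2
  have h₃ : b * (p + q)⁻¹ = p - q := by
    rw [mul_inv_eq_iff_eq_mul₀ (by positivity)]
    linear_combination hq2 - hp2
  have h₄ : b * (R + Q)⁻¹ = R - Q := by
    rw [mul_inv_eq_iff_eq_mul₀ (by positivity)]
    linear_combination hQ2 - hP2
  have h₅ : (p + q) * (p + q)⁻¹ = 1 := mul_inv_cancel₀ (by positivity)
  have h₆ : (R + Q) * (R + Q)⁻¹ = 1 := mul_inv_cancel₀ (by positivity)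
  calc p - q - R + Q = b * (p + q)⁻¹ - b * (R + Q)⁻¹ := by rw [h₃, h₄]; ring
    _ = b * ((R - p) + (Q - q)) * ((p + q)⁻¹ * (R + Q)⁻¹) := by
      linear_combination (-b * (p + q)⁻¹) * h₆ + (b * (R + Q)⁻¹) * h₅
    _ = b * d * ((R + p)⁻¹ + (Q + q)⁻¹) * ((p + q)⁻¹ * (R + Q)⁻¹) := by
      rw [← h₁, ← h₂]; ring

theorem sqrt_mixed_difference_nonneg {x b d : ℝ} (hx : 0 ≤ x) (hb : 0 < b) (hd : 0 < d) :
    0 ≤ √(x + b) - √x - √(x + b + d) + √(x + d) := by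
  rw [sqrt_mixed_difference hx hb hd]
  positivity

theorem sqrt_mixed_difference_antitone {x y b d : ℝ} (hx : 0 ≤ x) (hxy : x ≤ y) (hb : 0 < b)
    (hd : 0 < d) :
    √(y + b) - √y - √(y + b + d) + √(y + d) ≤ √(x + b) - √x - √(x + b + d) + √(x + d) := by
  rw [sqrt_mixed_difference hx hb hd, sqrt_mixed_difference (hx.trans hxy) hb hd]
  have hp : 0 < √(x + b) := Real.sqrt_pos.2 (by linarith)
  have hQ : 0 < √(x + d) := Real.sqrt_pos.2 (by linarith)
  gcongr

theorem sqrt_mixed_difference_le {x b d : ℝ} (hx : 0 ≤ x) (hb : 0 < b) (hd : 0 < d) :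
    √(x + b) - √x - √(x + b + d) + √(x + d) ≤ b * d / ((x + b) * √(x + d)) := by
  rw [sqrt_mixed_difference hx hb hd]
  have hq := Real.sqrt_nonneg x
  have hp : 0 < √(x + b) := Real.sqrt_pos.2 (by linarith)
  have hQ : 0 < √(x + d) := Real.sqrt_pos.2 (by linarith)
  have hpP : √(x + b) ≤ √(x + b + d) := Real.sqrt_le_sqrt (by linarith)
  have hp2 := Real.sq_sqrt (show 0 ≤ x + b by linarith)
  generalize √x = q at *
  generalize √(x + b) = p at *
  generalize √(x + d) = Q at *
  generalize √(x + b + d) = R at *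
  rw [← hp2]
  have hR : 0 < R := hp.trans_le hpP
  have h₁ : (R + p)⁻¹ + (Q + q)⁻¹ ≤ p⁻¹ + Q⁻¹ := by
    gcongr <;> linarith
  have h₂ : (p + q)⁻¹ ≤ p⁻¹ := by
    gcongr
    linarith
  have h₃ : (R + Q)⁻¹ ≤ (p + Q)⁻¹ := by
    gcongr
  calc b * d * ((R + p)⁻¹ + (Q + q)⁻¹) * ((p + q)⁻¹ * (R + Q)⁻¹)
      ≤ b * d * (p⁻¹ + Q⁻¹) * (p⁻¹ * (p + Q)⁻¹) := by gcongr
    _ = b * d / (p ^ 2 * Q) := by field_simp; ring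

/-- Lemma 2.2: for all `0 ≤ s < t ≤ u < v`,
`|E[(F(v) − F(u))(F(t) − F(s))]| ≤ √(2/π)(t−s)(v−u)/((u−s)√(v−t))`. -/
theorem heat_increment_cov_bound {Ω : Type*} [MeasurableSpace Ω]
    (P : Measure Ω) (F : ℝ → Ω → ℝ) (hF : IsHeatGaussian P F)
    (s t u v : ℝ) (hs : 0 ≤ s) (hst : s < t) (htu : t ≤ u) (huv : u < v) :
    |∫ ω, (F v ω - F u ω) * (F t ω - F s ω) ∂P| ≤
      Real.sqrt (2 / Real.pi) * ((t - s) * (v - u)) /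
        ((u - s) * Real.sqrt (v - t)) := by
  rw [hF.integral_sub_mul_sub hs (by linarith) (by linarith) (by linarith)]
  have hb : 0 < t - s := by linarith
  have hd : 0 < v - u := by linarith
  have ha : 0 ≤ u - t := by linarith
  have hA := sqrt_mixed_difference_nonneg (x := u + s) (by linarith) hb hd
  have hAB := sqrt_mixed_difference_antitone ha (show u - t ≤ u + s by linarith) hb hd
  have hB := sqrt_mixed_difference_le ha hb hd
  rw [show u + s + (t - s) = t + u by ring, show t + u + (v - u) = t + v by ring,
    show u + s + (v - u) = s + v by ring, show u + s = s + u by ring] at hA hAB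
  rw [show u - t + (t - s) = u - s by ring, show u - s + (v - u) = v - s by ring,
    show u - t + (v - u) = v - t by ring] at hAB hB
  have hK : ∀ {x y : ℝ}, x ≤ y → covK y x = (√(2 * Real.pi))⁻¹ * (√(x + y) - √(y - x)) := by
    intro x y hxy
    rw [covK, abs_of_nonpos (by linarith), neg_sub]
  rw [hK (by linarith), hK (by linarith), hK htu, hK (by linarith)]
  have hc : √(2 / Real.pi) = (√(2 * Real.pi))⁻¹ * 2 := by
    rw [← Real.sqrt_inv, show (2 : ℝ) / Real.pi = (2 * Real.pi)⁻¹ * 2 ^ 2 by field_simp,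
      Real.sqrt_mul (by positivity), Real.sqrt_sq (by norm_num)]
  rw [hc, mul_div_assoc, mul_assoc, ← mul_sub, ← mul_sub, ← mul_sub, abs_mul,
    abs_of_nonneg (show 0 ≤ (√(2 * Real.pi))⁻¹ by positivity)]
  gcongr
  rw [abs_le]
  constructor <;> linarith
end

section
/- Let ρ ∈ [−1, 1], η = √(1 − ρ²), and let U, V be independent standard Gaussian real random variables. Set X_1 = U and X_2 = ρU + ηV (so X_1, X_2 are jointly Gaussian with mean zero, variance one, and correlation ρ). Then E[ X_1|X_1| · X_2|X_2| ] = K₀(ρ), where K₀(x) = (6/π)·x·√(1−x²) + (2/π)·(1+2x²)·arcsin(x). -/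
open MeasureTheory ProbabilityTheory

/-- `K₀(x) = (6/π)x√(1−x²) + (2/π)(1+2x²)arcsin x`. -/
noncomputable def K0 (x : ℝ) : ℝ :=
  6 / Real.pi * x * Real.sqrt (1 - x ^ 2) +
    2 / Real.pi * (1 + 2 * x ^ 2) * Real.arcsin x

open Real in
theorem integral_gaussianReal_prod_of_homogeneous {n : ℕ} {f : ℝ × ℝ → ℝ} {g : ℝ → ℝ}
    (hfg : ∀ r > 0, ∀ θ, f (r * cos θ, r * sin θ) = r ^ n * g θ) :
    ∫ p, f p ∂((gaussianReal 0 1).prod (gaussianReal 0 1)) =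
      (2 * π)⁻¹ * (∫ r in Set.Ioi (0 : ℝ), r ^ (n + 1) * exp (-r ^ 2 / 2)) *
        ∫ θ in -π..π, g θ := by
  rw [gaussianReal_of_var_ne_zero 0 one_ne_zero,
    prod_withDensity (measurable_gaussianPDF 0 1) (measurable_gaussianPDF 0 1),
    integral_withDensity_eq_integral_toReal_smul (by fun_prop)
      (.of_forall fun p ↦ ENNReal.mul_lt_top gaussianPDF_lt_top gaussianPDF_lt_top),
    ← Measure.volume_eq_prod, ← integral_comp_polarCoord_symm, mul_assoc,
    intervalIntegral.integral_of_le (by linarith [pi_pos]), integral_Ioc_eq_integral_Ioo,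
    ← setIntegral_prod_mul, ← integral_const_mul, ← Measure.volume_eq_prod]
  refine setIntegral_congr_fun (measurableSet_Ioi.prod measurableSet_Ioo) fun p hp ↦ ?_
  have hsqrt : (√(2 * π))⁻¹ * (√(2 * π))⁻¹ = (2 * π)⁻¹ := by
    rw [← mul_inv, mul_self_sqrt (by positivity)]
  have hexp : exp (-(p.1 * cos p.2) ^ 2 / 2) * exp (-(p.1 * sin p.2) ^ 2 / 2) =
      exp (-p.1 ^ 2 / 2) := by
    rw [← exp_add]
    congr 1
    linear_combination (-p.1 ^ 2 / 2) * sin_sq_add_cos_sq p.2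
  simp only [polarCoord_symm_apply, hfg p.1 hp.1, ENNReal.toReal_mul, toReal_gaussianPDF,
    gaussianPDFReal_def, smul_eq_mul, sub_zero, NNReal.coe_one, mul_one]
  rw [← hsqrt, ← hexp]
  ring

open Real in
theorem integral_Ioi_pow_five_mul_exp_neg_sq_div_two :
    ∫ r in Set.Ioi (0 : ℝ), r ^ 5 * exp (-r ^ 2 / 2) = 8 := by
  have h := integral_rpow_mul_exp_neg_mul_rpow (p := 2) (q := 5) (b := 1 / 2)
    (by norm_num) (by norm_num) (by norm_num)
  have hΓ : Gamma 3 = 2 := by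
    simp [Gamma_ofNat_eq_factorial, Nat.factorial]
  have hpow : ((1 : ℝ) / 2) ^ (-3 : ℝ) = 8 := by
    rw [rpow_neg (by norm_num)]
    norm_num
  rw [show (-(5 + 1) / 2 : ℝ) = -3 by norm_num, show ((5 + 1) / 2 : ℝ) = 3 by norm_num, hpow, hΓ,
    show (8 * (1 / 2) * 2 : ℝ) = 8 by norm_num] at h
  rw [← h]
  refine setIntegral_congr_fun measurableSet_Ioi fun r _ ↦ ?_
  simp only [rpow_ofNat]
  congr 2
  ring

open Real in
theorem integral_sq_cos_mul_sin_add (α a b : ℝ) :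
    ∫ θ in a..b, (cos θ * sin (θ + α)) ^ 2 =
      ((1 / 2 + sin α ^ 2) * (b - a) - (sin (4 * b + 2 * α) - sin (4 * a + 2 * α)) / 8 -
        sin α * (cos (2 * b + α) - cos (2 * a + α))) / 4 := by
  have hderiv (θ : ℝ) : HasDerivAt
      (fun θ ↦ ((1 / 2 + sin α ^ 2) * θ - sin (4 * θ + 2 * α) / 8 -
        sin α * cos (2 * θ + α)) / 4) ((cos θ * sin (θ + α)) ^ 2) θ := by
    have h4 : HasDerivAt (fun θ : ℝ ↦ 4 * θ + 2 * α) 4 θ := by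
      simpa using ((hasDerivAt_id θ).const_mul 4).add_const (2 * α)
    have h2 : HasDerivAt (fun θ : ℝ ↦ 2 * θ + α) 2 θ := by
      simpa using ((hasDerivAt_id θ).const_mul 2).add_const α
    have hmul : cos θ * sin (θ + α) = (sin (2 * θ + α) + sin α) / 2 := by
      have h₁ := sin_add (θ + α) θ
      have h₂ := sin_sub (θ + α) θ
      rw [show θ + α + θ = 2 * θ + α by ring] at h₁
      rw [add_sub_cancel_left] at h₂
      linear_combination -(h₁ + h₂) / 2
    have hcos : cos (4 * θ + 2 * α) = 1 - 2 * sin (2 * θ + α) ^ 2 := by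
      rw [show 4 * θ + 2 * α = 2 * (2 * θ + α) by ring, cos_two_mul, cos_sq']
      ring
    convert! (((((hasDerivAt_id θ).const_mul (1 / 2 + sin α ^ 2)).sub
      (h4.sin.div_const 8)).sub (h2.cos.const_mul (sin α))).div_const 4) using 1
    rw [hmul, hcos]
    ring
  rw [intervalIntegral.integral_eq_sub_of_hasDerivAt (fun θ _ ↦ hderiv θ)
    (by apply Continuous.intervalIntegrable; fun_prop)]
  ring

open Real in
theorem integral_cos_mul_abs_mul_sin_add_mul_abs {α : ℝ} (hα : α ∈ Set.Icc (-(π / 2)) (π / 2)) :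
    ∫ θ in -π..π, (cos θ * |cos θ|) * (sin (θ + α) * |sin (θ + α)|) =
      3 / 2 * sin α * cos α + (1 / 2 + sin α ^ 2) * α := by
  obtain ⟨hα₁, hα₂⟩ := hα
  set g : ℝ → ℝ := fun θ ↦ (cos θ * |cos θ|) * (sin (θ + α) * |sin (θ + α)|) with hg
  have hcont : Continuous g := by fun_prop
  have hper : Function.Periodic g π := fun θ ↦ by
    simp only [hg, show θ + π + α = θ + α + π by ring, cos_add_pi, sin_add_pi, abs_neg]
    ring
  have hint (a b : ℝ) : IntervalIntegrable g volume a b := hcont.intervalIntegrable a b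
  have hhalf (t : ℝ) : ∫ θ in t..t + π, g θ = ∫ θ in -(π / 2)..π / 2, g θ := by
    rw [hper.intervalIntegral_add_eq t (-(π / 2)), show -(π / 2) + π = π / 2 by ring]
  have hleft := hhalf (-π)
  have hright := hhalf 0
  rw [neg_add_cancel] at hleft
  rw [zero_add] at hright
  have hneg : ∫ θ in -(π / 2)..-α, g θ = -∫ θ in -(π / 2)..-α, (cos θ * sin (θ + α)) ^ 2 := by
    rw [← intervalIntegral.integral_neg]
    refine intervalIntegral.integral_congr fun θ hθ ↦ ?_
    rw [Set.uIcc_of_le (by linarith)] at hθ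
    have hc : 0 ≤ cos θ := cos_nonneg_of_mem_Icc ⟨hθ.1, by linarith [hθ.2]⟩
    have hs : sin (θ + α) ≤ 0 :=
      sin_nonpos_of_nonpos_of_neg_pi_le (by linarith [hθ.2]) (by linarith [hθ.1])
    simp only [hg, abs_of_nonneg hc, abs_of_nonpos hs]
    ring
  have hpos : ∫ θ in -α..π / 2, g θ = ∫ θ in -α..π / 2, (cos θ * sin (θ + α)) ^ 2 := by
    refine intervalIntegral.integral_congr fun θ hθ ↦ ?_
    rw [Set.uIcc_of_le (by linarith)] at hθ
    have hc : 0 ≤ cos θ := cos_nonneg_of_mem_Icc ⟨by linarith [hθ.1], hθ.2⟩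
    have hs : 0 ≤ sin (θ + α) :=
      sin_nonneg_of_nonneg_of_le_pi (by linarith [hθ.1]) (by linarith [hθ.2])
    simp only [hg, abs_of_nonneg hc, abs_of_nonneg hs]
    ring
  rw [← intervalIntegral.integral_add_adjacent_intervals (hint (-π) 0) (hint 0 π), hleft, hright,
    ← intervalIntegral.integral_add_adjacent_intervals (hint (-(π / 2)) (-α)) (hint (-α) (π / 2)),
    hneg, hpos, integral_sq_cos_mul_sin_add, integral_sq_cos_mul_sin_add,
    show 4 * (π / 2) + 2 * α = 2 * α + 2 * π by ring, sin_add_two_pi,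
    show 4 * -(π / 2) + 2 * α = 2 * α - 2 * π by ring, sin_sub_two_pi,
    show 2 * (π / 2) + α = α + π by ring, cos_add_pi,
    show 2 * -(π / 2) + α = α - π by ring, cos_sub_pi,
    show 4 * -α + 2 * α = -(2 * α) by ring, sin_neg,
    show 2 * -α + α = -α by ring, cos_neg, sin_two_mul]
  ring


/-- Lemma 4.3 (formula): if `U, V` are independent standard Gaussians,
`X₁ = U`, `X₂ = ρU + √(1−ρ²)V`, then `E[X₁|X₁| ⬝ X₂|X₂|] = K₀(ρ)`. -/
theorem signed_square_correlation {Ω : Type*} [MeasurableSpace Ω]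
    (P : Measure Ω) [IsProbabilityMeasure P]
    (U V : Ω → ℝ) (hU : Measurable U) (hV : Measurable V)
    (hUlaw : Measure.map U P = gaussianReal 0 1)
    (hVlaw : Measure.map V P = gaussianReal 0 1)
    (hUV : IndepFun U V P)
    (ρ : ℝ) (hρ : ρ ∈ Set.Icc (-1 : ℝ) 1) :
    ∫ ω, (U ω * |U ω|) *
        ((ρ * U ω + Real.sqrt (1 - ρ ^ 2) * V ω) *
          |ρ * U ω + Real.sqrt (1 - ρ ^ 2) * V ω|) ∂P = K0 ρ := by
  have hsin : Real.sin (Real.arcsin ρ) = ρ := Real.sin_arcsin hρ.1 hρ.2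
  have hcos : Real.cos (Real.arcsin ρ) = Real.sqrt (1 - ρ ^ 2) := Real.cos_arcsin ρ
  have hmap : Measure.map (fun ω ↦ (U ω, V ω)) P =
      (gaussianReal 0 1).prod (gaussianReal 0 1) := by
    rw [hUV.map_prod_eq_prod_map_map hU.aemeasurable hV.aemeasurable, hUlaw, hVlaw]
  let f : ℝ × ℝ → ℝ := fun p ↦ (p.1 * |p.1|) *
    ((ρ * p.1 + Real.sqrt (1 - ρ ^ 2) * p.2) * |ρ * p.1 + Real.sqrt (1 - ρ ^ 2) * p.2|)
  have hf : Continuous f := by fun_prop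
  have hpolar (r : ℝ) (hr : r > 0) (θ : ℝ) : f (r * Real.cos θ, r * Real.sin θ) =
      r ^ 4 * ((Real.cos θ * |Real.cos θ|) *
        (Real.sin (θ + Real.arcsin ρ) * |Real.sin (θ + Real.arcsin ρ)|)) := by
    have hlin : ρ * (r * Real.cos θ) + Real.sqrt (1 - ρ ^ 2) * (r * Real.sin θ) =
        r * Real.sin (θ + Real.arcsin ρ) := by
      rw [Real.sin_add, hsin, hcos]
      ring
    simp only [f, hlin, abs_mul, abs_of_pos hr]
    ring
  calc
    _ = ∫ p, f p ∂(Measure.map (fun ω ↦ (U ω, V ω)) P) :=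
      (integral_map (hU.prodMk hV).aemeasurable hf.aestronglyMeasurable).symm
    _ = K0 ρ := by
      rw [hmap, integral_gaussianReal_prod_of_homogeneous hpolar,
        integral_Ioi_pow_five_mul_exp_neg_sq_div_two,
        integral_cos_mul_abs_mul_sin_add_mul_abs (Real.arcsin_mem_Icc ρ), hsin, hcos, K0]
      field_simp
      ring
end

section
/- For every x ∈ [−1, 1], the function K₀(x) = (6/π)x√(1−x²) + (2/π)(1+2x²)·arcsin(x) satisfies | K₀(x) − (8/π)x | ≤ 2|x|³; in particular |K₀(x)| ≤ 5|x| for all x ∈ [−1, 1]. -/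
theorem K0_neg (x : ℝ) : K0 (-x) = -K0 x := by
  simp only [K0, Real.arcsin_neg, neg_sq]
  ring

theorem le_arcsin_self {x : ℝ} (h0 : 0 ≤ x) (h1 : x ≤ 1) : x ≤ Real.arcsin x := by
  have h := Real.sin_le (Real.arcsin_nonneg.2 h0)
  rwa [Real.sin_arcsin (by linarith) h1] at h

theorem arcsin_le_add_cube {x : ℝ} (h0 : 0 ≤ x) (h1 : x ≤ 1) :
    Real.arcsin x ≤ x + 7 / 10 * x ^ 3 := by
  have ha := Real.arcsin_nonneg.2 h0
  have hsin := Real.sin_arcsin (by linarith) h1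
  have hcube := Real.sin_ge_sub_cube ha
  have hlin : Real.arcsin x ≤ 1.575 * x := by
    have h := Real.mul_le_sin ha (Real.arcsin_le_pi_div_two x)
    rw [hsin, div_mul_eq_mul_div, div_le_iff₀ Real.pi_pos] at h
    nlinarith [Real.pi_lt_d2]
  have hpow := pow_le_pow_left₀ ha hlin 3
  rw [hsin] at hcube
  nlinarith [pow_nonneg h0 3]

theorem abs_K0_sub_le_of_nonneg {x : ℝ} (h0 : 0 ≤ x) (h1 : x ≤ 1) :
    |K0 x - 8 / Real.pi * x| ≤ 2 * x ^ 3 := by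
  have hpi := Real.pi_pos
  have hx2 : x ^ 2 ≤ 1 := pow_le_one₀ h0 h1
  have hx3 := pow_nonneg h0 3
  have hx5 : x ^ 5 ≤ x ^ 3 := pow_le_pow_of_le_one h0 h1 (by norm_num)
  have hpi3 : 3.14 * x ^ 3 ≤ Real.pi * x ^ 3 :=
    mul_le_mul_of_nonneg_right Real.pi_gt_d2.le hx3
  have hslo : 1 - x ^ 2 ≤ Real.sqrt (1 - x ^ 2) :=
    Real.le_sqrt_of_sq_le (by nlinarith [sq_nonneg x])
  have hshi : Real.sqrt (1 - x ^ 2) ≤ 1 - x ^ 2 / 2 :=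
    Real.sqrt_le_iff.2 ⟨by linarith, by nlinarith [sq_nonneg (x ^ 2)]⟩
  have hs1 := mul_le_mul_of_nonneg_left hslo h0
  have hs2 := mul_le_mul_of_nonneg_left hshi h0
  have hw : 0 ≤ 1 + 2 * x ^ 2 := by positivity
  have ha1 := mul_le_mul_of_nonneg_left (le_arcsin_self h0 h1) hw
  have ha2 := mul_le_mul_of_nonneg_left (arcsin_le_add_cube h0 h1) hw
  have heq : K0 x - 8 / Real.pi * x = (6 * (x * Real.sqrt (1 - x ^ 2)) +
      2 * ((1 + 2 * x ^ 2) * Real.arcsin x) - 8 * x) / Real.pi := by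
    rw [K0]
    ring
  rw [heq, abs_le, le_div_iff₀ hpi, div_le_iff₀ hpi]
  constructor <;> nlinarith

theorem abs_K0_sub_le {x : ℝ} (hx : x ∈ Set.Icc (-1 : ℝ) 1) :
    |K0 x - 8 / Real.pi * x| ≤ 2 * |x| ^ 3 := by
  obtain h0 | h0 := le_total 0 x
  · rw [abs_of_nonneg h0]
    exact abs_K0_sub_le_of_nonneg h0 hx.2
  · have h := abs_K0_sub_le_of_nonneg (neg_nonneg.2 h0) (neg_le.1 hx.1)
    rwa [K0_neg, mul_neg, ← neg_sub', abs_neg, ← abs_of_nonpos h0] at h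

/-- Lemma 4.3 (estimate): for `x ∈ [−1,1]`, `|K₀(x) − (8/π)x| ≤ 2|x|³`, and in
particular `|K₀(x)| ≤ 5|x|`. -/
theorem K0_estimate (x : ℝ) (hx : x ∈ Set.Icc (-1 : ℝ) 1) :
    |K0 x - 8 / Real.pi * x| ≤ 2 * |x| ^ 3 ∧ |K0 x| ≤ 5 * |x| := by
  have hmain := abs_K0_sub_le hx
  refine ⟨hmain, ?_⟩
  have habs := abs_nonneg x
  have hcube : |x| ^ 3 ≤ |x| := pow_le_of_le_one habs (abs_le.2 hx) (by norm_num)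
  have hlin : |8 / Real.pi * x| ≤ 3 * |x| := by
    rw [abs_mul, abs_of_pos (div_pos (by norm_num) Real.pi_pos)]
    refine mul_le_mul_of_nonneg_right ?_ habs
    rw [div_le_iff₀ Real.pi_pos]
    linarith [Real.pi_gt_three]
  have htri := abs_sub_abs_le_abs_sub (K0 x) (8 / Real.pi * x)
  linarith
end
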